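/- Let p > 0, a > 0, b > 0, and let I : [T₀, T₁] → ℝ be a differentiable function with I(t) > 0 for all t ∈ [T₀, T₁], satisfying -b·I(t)^(p+1) ≤ I'(t) ≤ a·I(t) - b·I(t)^(p+1) for all t ∈ [T₀, T₁]. Then for all t ∈ [T₀, T₁]: I(T₀)^(-p)·exp(-p·a·(t - T₀)) + (b/a)·(1 - exp(-p·a·(t - T₀))) ≤ I(t)^(-p) ≤ p·b·(t - T₀) + I(T₀)^(-p). -/

import Mathlib

theorem monotoneOn_Icc_of_hasDerivAt_nonneg {f f' : ℝ → ℝ} {x y : ℝ}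
    (hf : ∀ t ∈ Set.Icc x y, HasDerivAt f (f' t) t) (hf' : ∀ t ∈ Set.Icc x y, 0 ≤ f' t) :
    MonotoneOn f (Set.Icc x y) :=
  monotoneOn_of_hasDerivWithinAt_nonneg (convex_Icc x y)
    (fun t ht => (hf t ht).continuousAt.continuousWithinAt)
    (fun t ht => (hf t (interior_subset ht)).hasDerivWithinAt)
    (fun t ht => hf' t (interior_subset ht))

/-- Grönwall's lower bound for the linear differential inequality `u' ≥ c - k * u`. -/
theorem exp_lower_bound_of_linear_deriv_ge {u u' : ℝ → ℝ} {x y k c : ℝ} (hk : k ≠ 0)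
    (hu : ∀ t ∈ Set.Icc x y, HasDerivAt u (u' t) t)
    (hu' : ∀ t ∈ Set.Icc x y, c - k * u t ≤ u' t) {t : ℝ} (ht : t ∈ Set.Icc x y) :
    u x * Real.exp (-k * (t - x)) + c / k * (1 - Real.exp (-k * (t - x))) ≤ u t := by
  have hmono : MonotoneOn (fun s => (u s - c / k) * Real.exp (k * (s - x))) (Set.Icc x y) := by
    refine monotoneOn_Icc_of_hasDerivAt_nonneg
      (f' := fun s => (u' s - (c - k * u s)) * Real.exp (k * (s - x))) (fun s hs => ?_)
      (fun s hs => mul_nonneg (sub_nonneg.2 (hu' s hs)) (Real.exp_pos _).le)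
    refine (((hu s hs).sub_const (c / k)).mul
      (((hasDerivAt_id s).sub_const x).const_mul k).exp).congr_deriv ?_
    simp only [id]
    field_simp
    ring
  have h := hmono (Set.left_mem_Icc.2 (ht.1.trans ht.2)) ht ht.1
  simp only [sub_self, mul_zero, Real.exp_zero, mul_one] at h
  have hexp : Real.exp (k * (t - x)) * Real.exp (-k * (t - x)) = 1 := by
    rw [← Real.exp_add, neg_mul, add_neg_cancel, Real.exp_zero]
  have h' := mul_le_mul_of_nonneg_right h (Real.exp_pos (-k * (t - x))).le
  rw [mul_assoc, hexp] at h'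
  linarith


/-- Bernoulli type differential inequality, case p > 0 (Lemma 3.5):
if I > 0 and -b·I^(p+1) ≤ I' ≤ a·I - b·I^(p+1) on [T₀, T₁], then
I(T₀)^(-p)·e^(-pa(t-T₀)) + (b/a)(1 - e^(-pa(t-T₀))) ≤ I(t)^(-p) ≤ pb(t-T₀) + I(T₀)^(-p). -/
theorem bernoulli_inequality_pos_p (p a b T₀ T₁ : ℝ)
    (hp : 0 < p) (ha : 0 < a) (hb : 0 < b)
    (I I' : ℝ → ℝ)
    (hderiv : ∀ t ∈ Set.Icc T₀ T₁, HasDerivAt I (I' t) t)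
    (hpos : ∀ t ∈ Set.Icc T₀ T₁, 0 < I t)
    (hineq : ∀ t ∈ Set.Icc T₀ T₁,
      -b * I t ^ (p + 1) ≤ I' t ∧ I' t ≤ a * I t - b * I t ^ (p + 1)) :
    ∀ t ∈ Set.Icc T₀ T₁,
      I T₀ ^ (-p) * Real.exp (-p * a * (t - T₀)) +
        b / a * (1 - Real.exp (-p * a * (t - T₀))) ≤ I t ^ (-p) ∧
      I t ^ (-p) ≤ p * b * (t - T₀) + I T₀ ^ (-p) := by
  have hu : ∀ t ∈ Set.Icc T₀ T₁,
      HasDerivAt (fun s => I s ^ (-p)) (I' t * (-p) * I t ^ (-p - 1)) t :=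
    fun t ht => (hderiv t ht).rpow_const (Or.inl (hpos t ht).ne')
  have hcancel : ∀ t ∈ Set.Icc T₀ T₁, I t ^ (p + 1) * I t ^ (-p - 1) = 1 := fun t ht => by
    rw [← Real.rpow_add (hpos t ht), show p + 1 + (-p - 1) = 0 by ring, Real.rpow_zero]
  have hmul : ∀ t ∈ Set.Icc T₀ T₁, I t * I t ^ (-p - 1) = I t ^ (-p) := fun t ht => by
    rw [Real.rpow_sub_one (hpos t ht).ne', mul_div_cancel₀ _ (hpos t ht).ne']
  have hnonneg : ∀ t ∈ Set.Icc T₀ T₁, 0 ≤ p * I t ^ (-p - 1) := fun t ht =>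
    mul_nonneg hp.le (Real.rpow_nonneg (hpos t ht).le _)
  intro t ht
  constructor
  · have h := exp_lower_bound_of_linear_deriv_ge (k := p * a) (c := p * b)
      (mul_pos hp ha).ne' hu (fun s hs => ?_) ht
    · rwa [mul_div_mul_left _ _ hp.ne', ← neg_mul] at h
    · have h := mul_le_mul_of_nonneg_right (hineq s hs).2 (hnonneg s hs)
      linear_combination h + p * a * hmul s hs - p * b * hcancel s hs
  · have hmono : MonotoneOn (fun s => p * b * s - I s ^ (-p)) (Set.Icc T₀ T₁) := by
      refine monotoneOn_Icc_of_hasDerivAt_nonneg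
        (fun s hs => ((hasDerivAt_id s).const_mul (p * b)).sub (hu s hs)) (fun s hs => ?_)
      have h := mul_le_mul_of_nonneg_right (hineq s hs).1 (hnonneg s hs)
      linear_combination h + p * b * hcancel s hs
    have h := hmono (Set.left_mem_Icc.2 (ht.1.trans ht.2)) ht ht.1
    simp only at h
    linarith
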